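/- Let d ≥ 1, let q be a real polynomial in one variable, and let G ∈ HM_{d+1} be a Hermitian matrix such that ζ(λ) G ζ(λ)* = q(λ) for all λ ∈ ℝ, where ζ(λ) = (λ^d, λ^{d−1}, …, λ, 1) is a row vector. Let a, b ∈ ℝ with a < b, let M = (I_d, 0) and N = (0, I_d) ∈ ℝ^{d×(d+1)} (the d×(d+1) matrices obtained by appending a zero column to the d×d identity on the right and on the left, respectively), and let Θ₁ = [[0, −i], [i, 0]] and Θ₂ = [[−1, (a+b)/2], [(a+b)/2, −ab]]. Then q(λ) > 0 for all λ ∈ [a, b] if and only if there exist Hermitian d×d matrices H₁, H₂ with H₂ ≻ 0 such that G ≻ Λ'_{M,N,Θ₁}(H₁) + Λ'_{M,N,Θ₂}(H₂). -/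

import Mathlib

open Matrix ComplexOrder

/-- The adjoint generalized Lyapunov operator
`Λ'_{M,N,Θ}(H) = θ₁₁ M*HM + θ₂₁ M*HN + θ₁₂ N*HM + θ₂₂ N*HN`. -/
noncomputable def lyapAdj {k z : Type*} [Fintype k] (M N : Matrix k z ℂ)
    (Θ : Matrix (Fin 2) (Fin 2) ℂ) (H : Matrix k k ℂ) : Matrix z z ℂ :=
  Θ 0 0 • (Mᴴ * H * M) + Θ 1 0 • (Mᴴ * H * N) + Θ 0 1 • (Nᴴ * H * M) + Θ 1 1 • (Nᴴ * H * N)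

section IntervalCone

open Polynomial

/-- The cone of real polynomials generated by the products `(X - a)^i (b - X)^j f²` whose formal
degree is `n`. -/
noncomputable def intervalCone (a b : ℝ) (n : ℕ) : AddSubmonoid ℝ[X] :=
  AddSubmonoid.closure {p | ∃ (i j m : ℕ) (f : ℝ[X]), f.natDegree ≤ m ∧ i + j + 2 * m = n ∧
    p = (X - C a) ^ i * (C b - X) ^ j * f ^ 2}

variable {a b : ℝ}

theorem mem_intervalCone_of_eq {n : ℕ} (i j m : ℕ) (f : ℝ[X]) (hf : f.natDegree ≤ m)
    (hn : i + j + 2 * m = n) : (X - C a) ^ i * (C b - X) ^ j * f ^ 2 ∈ intervalCone a b n :=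
  AddSubmonoid.subset_closure ⟨i, j, m, f, hf, hn, rfl⟩

theorem mul_mem_intervalCone {m n : ℕ} {p q : ℝ[X]} (hp : p ∈ intervalCone a b m)
    (hq : q ∈ intervalCone a b n) : p * q ∈ intervalCone a b (m + n) := by
  have h := AddSubmonoid.mul_mem_mul hp hq
  rw [intervalCone, intervalCone, AddSubmonoid.closure_mul_closure] at h
  refine AddSubmonoid.closure_le.2 ?_ h
  rintro _ ⟨_, ⟨i, j, k, f, hf, rfl, rfl⟩, _, ⟨i', j', k', f', hf', rfl, rfl⟩, rfl⟩
  have := mem_intervalCone_of_eq (a := a) (b := b)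
    (n := i + j + 2 * k + (i' + j' + 2 * k')) (i + i') (j + j') (k + k') (f * f')
    (natDegree_mul_le.trans (by lia)) (by lia)
  rw [SetLike.mem_coe]
  convert this using 1
  ring

theorem C_mem_intervalCone {c : ℝ} (hc : 0 ≤ c) : C c ∈ intervalCone a b 0 := by
  have := mem_intervalCone_of_eq (a := a) (b := b) (n := 0) 0 0 0 (C √c) (by simp) rfl
  simpa [← C_pow, Real.sq_sqrt hc] using this

theorem linear_mem_intervalCone (hab : a < b) {p : ℝ[X]} (hp : p.natDegree ≤ 1)
    (ha : 0 ≤ p.eval a) (hb : 0 ≤ p.eval b) : p ∈ intervalCone a b 1 := by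
  have hba : 0 < b - a := sub_pos.2 hab
  have h₁ := mul_mem_intervalCone (C_mem_intervalCone (a := a) (b := b)
    (div_nonneg hb hba.le)) (mem_intervalCone_of_eq (n := 1) 1 0 0 1 (by simp) rfl)
  have h₂ := mul_mem_intervalCone (C_mem_intervalCone (a := a) (b := b)
    (div_nonneg ha hba.le)) (mem_intervalCone_of_eq (n := 1) 0 1 0 1 (by simp) rfl)
  convert add_mem h₁ h₂ using 1
  obtain ⟨c, e, rfl⟩ := exists_eq_X_add_C_of_natDegree_le_one hp
  refine Polynomial.funext fun x => ?_
  simp only [eval_add, eval_mul, eval_C, eval_X, eval_sub, eval_pow, eval_one]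
  field_simp
  ring

theorem intervalCone_mono (hab : a < b) {m n : ℕ} (h : m ≤ n) :
    intervalCone a b m ≤ intervalCone a b n := by
  induction n, h using Nat.le_induction with
  | base => exact le_rfl
  | succ n _ ih =>
    intro p hp
    simpa using mul_mem_intervalCone (ih hp)
      (linear_mem_intervalCone hab (p := 1) (by simp) (by simp) (by simp))

theorem quadratic_mem_intervalCone {p : ℝ[X]} (hp : p.natDegree = 2)
    (hpos : ∀ x, 0 < p.eval x) : p ∈ intervalCone a b 2 := by
  have hp' := p.as_sum_range
  rw [hp] at hp'
  simp only [Finset.sum_range_succ, Finset.sum_range_zero, ← C_mul_X_pow_eq_monomial] at hp'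
  have hlead : p.coeff 2 ≠ 0 := by
    rw [← hp, coeff_natDegree, leadingCoeff_ne_zero]
    rintro rfl
    simp at hp
  generalize p.coeff 0 = s at *
  generalize p.coeff 1 = t at *
  generalize p.coeff 2 = r at *
  have he : ∀ x, p.eval x = s + t * x + r * x ^ 2 := by
    intro x
    rw [hp']
    simp
  simp only [he] at hpos
  have hr : 0 < r := by
    by_contra! hr
    have hr' : r < 0 := lt_of_le_of_ne hr hlead
    have hs : 0 < s := by simpa using hpos 0
    have hsq : √(s / -r) ^ 2 = s / -r := Real.sq_sqrt (div_nonneg hs.le (by linarith))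
    have h₁ := hpos √(s / -r)
    have h₂ := hpos (-√(s / -r))
    rw [neg_sq] at h₂
    have h₃ : r * √(s / -r) ^ 2 = -s := by
      rw [hsq]
      field_simp
    linarith
  have hc : 0 ≤ s - t ^ 2 / (4 * r) := by
    have := hpos (-t / (2 * r))
    have e : s + t * (-t / (2 * r)) + r * (-t / (2 * r)) ^ 2 = s - t ^ 2 / (4 * r) := by
      field_simp
      ring
    linarith
  have h₁ := mul_mem_intervalCone (C_mem_intervalCone (a := a) (b := b) hr.le)
    (mem_intervalCone_of_eq (n := 2) 0 0 1 (X + C (t / (2 * r))) (by simp) rfl)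
  have h₂ := mul_mem_intervalCone (C_mem_intervalCone (a := a) (b := b) hc)
    (mem_intervalCone_of_eq (n := 2) 0 0 1 1 (by simp) rfl)
  convert add_mem h₁ h₂ using 1
  refine Polynomial.funext fun x => ?_
  rw [he]
  simp only [eval_add, eval_mul, eval_C, eval_X, eval_sub, eval_pow, eval_one]
  field_simp
  ring

theorem eval_pos_or_neg_of_ne_zero {s : Set ℝ} (hs : s.OrdConnected) (p : ℝ[X])
    (h : ∀ x ∈ s, p.eval x ≠ 0) : (∀ x ∈ s, 0 < p.eval x) ∨ ∀ x ∈ s, 0 < (-p).eval x := by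
  by_contra! hcon
  obtain ⟨⟨x, hx, hx'⟩, y, hy, hy'⟩ := hcon
  rw [eval_neg, neg_nonpos] at hy'
  obtain ⟨z, hz, hz'⟩ := hs.isPreconnected.intermediate_value hx hy p.continuous.continuousOn
    ⟨hx', hy'⟩
  exact h z hz hz'

theorem irreducible_mem_intervalCone (hab : a < b) {p : ℝ[X]} (hp : Irreducible p)
    (hpos : ∀ x ∈ Set.Icc a b, 0 < p.eval x) : p ∈ intervalCone a b p.natDegree := by
  have ha := hpos a (Set.left_mem_Icc.2 hab.le)
  have hb := hpos b (Set.right_mem_Icc.2 hab.le)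
  have h2 : p.natDegree ≤ 2 := natDegree_le_of_degree_le hp.degree_le_two
  have h0 : 0 < p.natDegree := hp.natDegree_pos
  obtain h | h : p.natDegree = 1 ∨ p.natDegree = 2 := by lia
  · rw [h]
    exact linear_mem_intervalCone hab h.le ha.le hb.le
  · rw [h]
    refine quadratic_mem_intervalCone h ?_
    obtain H | H := eval_pos_or_neg_of_ne_zero Set.ordConnected_univ p
      fun x _ => hp.not_isRoot_of_natDegree_ne_one (by lia)
    · simpa using H
    · have := H a trivial
      rw [eval_neg] at this
      linarith

theorem mem_intervalCone_of_pos (hab : a < b) {n : ℕ} {p : ℝ[X]} (hn : p.natDegree ≤ n)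
    (hpos : ∀ x ∈ Set.Icc a b, 0 < p.eval x) : p ∈ intervalCone a b n := by
  induction n using Nat.strong_induction_on generalizing p with
  | _ n ih =>
    have ha := hpos a (Set.left_mem_Icc.2 hab.le)
    by_cases hp : p.natDegree = 0
    · rw [eq_C_of_natDegree_eq_zero hp] at ha ⊢
      rw [eval_C] at ha
      exact intervalCone_mono hab n.zero_le (C_mem_intervalCone ha.le)
    have hp0 : p ≠ 0 := by
      rintro rfl
      simp at ha
    obtain ⟨g, hg, h, rfl⟩ := WfDvdMonoid.exists_irreducible_factor
      (fun hu => hp (natDegree_eq_zero_of_isUnit hu)) hp0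
    have key : ∀ g h : ℝ[X], Irreducible g → (g * h).natDegree ≤ n → g * h ≠ 0 →
        (∀ x ∈ Set.Icc a b, 0 < (g * h).eval x) → (∀ x ∈ Set.Icc a b, 0 < g.eval x) →
        g * h ∈ intervalCone a b n := by
      intro g h hg hn h0 hpos hgpos
      rw [natDegree_mul (left_ne_zero_of_mul h0) (right_ne_zero_of_mul h0)] at hn
      have hd := hg.natDegree_pos
      have hh := ih (n - g.natDegree) (by lia) (p := h) (by lia) fun x hx => by
        have := hpos x hx
        rw [eval_mul] at this
        exact pos_of_mul_pos_right this (hgpos x hx).le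
      have := mul_mem_intervalCone (irreducible_mem_intervalCone hab hg hgpos) hh
      rwa [show g.natDegree + (n - g.natDegree) = n by lia] at this
    obtain H | H := eval_pos_or_neg_of_ne_zero Set.ordConnected_Icc g fun x hx h0 => by
      have := hpos x hx
      rw [eval_mul, h0, zero_mul] at this
      exact this.false
    · exact key g h hg hn hp0 hpos H
    · rw [← neg_mul_neg] at hn hp0 hpos ⊢
      exact key (-g) (-h) ((Associated.refl g).neg_right.irreducible hg) hn hp0 hpos H

end IntervalCone

section MomentVec

open Polynomial

/-- The vector `(l^(n-1), …, l, 1)`. -/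
noncomputable def momentVec (n : ℕ) (l : ℝ) : Fin n → ℂ := fun i => (l : ℂ) ^ (n - 1 - (i : ℕ))

theorem star_momentVec (n : ℕ) (l : ℝ) : star (momentVec n l) = momentVec n l := by
  ext i
  simp [momentVec]

theorem exists_dotProduct_momentVec_eq_eval {n : ℕ} {f : ℝ[X]} (hf : f.natDegree < n) :
    ∃ v : Fin n → ℂ, star v = v ∧ ∀ l, v ⬝ᵥ momentVec n l = (f.eval l : ℝ) := by
  refine ⟨fun i => (f.coeff (n - 1 - i) : ℝ), by ext; simp, fun l => ?_⟩
  rw [eval_eq_sum_range' hf, ← Finset.sum_range_reflect, ← Fin.sum_univ_eq_sum_range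
    (fun i => f.coeff (n - 1 - i) * l ^ (n - 1 - i))]
  simp [dotProduct, momentVec]

theorem exists_posSemidef_quadForm_eq_sq {n : ℕ} {f : ℝ[X]} (hf : f.natDegree < n) :
    ∃ T : Matrix (Fin n) (Fin n) ℂ, T.PosSemidef ∧
      ∀ l, star (momentVec n l) ⬝ᵥ T *ᵥ momentVec n l = (((f ^ 2).eval l : ℝ) : ℂ) := by
  obtain ⟨v, hv, h⟩ := exists_dotProduct_momentVec_eq_eval hf
  refine ⟨vecMulVec v (star v), posSemidef_vecMulVec_self_star v, fun l => ?_⟩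
  rw [vecMulVec_mulVec, hv, h, star_momentVec]
  rw [op_smul_eq_smul, dotProduct_smul, dotProduct_comm, h]
  simp [sq]

theorem natDegree_C_sub_X_le (b : ℝ) : (C b - X).natDegree ≤ 1 := by
  rw [← neg_sub, natDegree_neg]
  exact natDegree_X_sub_C_le b

theorem exists_posSemidef_of_mem_intervalCone {a b : ℝ} {d : ℕ} {p : ℝ[X]}
    (hp : p ∈ intervalCone a b (2 * d)) :
    ∃ (T : Matrix (Fin (d + 1)) (Fin (d + 1)) ℂ) (S : Matrix (Fin d) (Fin d) ℂ),
      T.PosSemidef ∧ S.PosSemidef ∧ ∀ l : ℝ, ((p.eval l : ℝ) : ℂ) =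
        star (momentVec (d + 1) l) ⬝ᵥ T *ᵥ momentVec (d + 1) l +
        (((l - a) * (b - l) : ℝ) : ℂ) * (star (momentVec d l) ⬝ᵥ S *ᵥ momentVec d l) := by
  unfold intervalCone at hp
  induction hp using AddSubmonoid.closure_induction with
  | mem p hp =>
    obtain ⟨i, j, m, f, hf, hij, rfl⟩ := hp
    have hdeg : ∀ s t, ((X - C a) ^ s * (C b - X) ^ t * f).natDegree ≤ s + t + m := by
      intro s t
      refine natDegree_mul_le_of_le (natDegree_mul_le_of_le ?_ ?_) hf
      · exact (natDegree_pow_le_of_le s (natDegree_X_sub_C_le a)).trans (by simp)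
      · exact (natDegree_pow_le_of_le t (natDegree_C_sub_X_le b)).trans (by simp)
    obtain ⟨s, hs⟩ := Nat.even_or_odd' i
    obtain ⟨t, ht⟩ := Nat.even_or_odd' j
    obtain ⟨rfl, rfl⟩ | ⟨rfl, rfl⟩ :
        (i = 2 * s ∧ j = 2 * t) ∨ (i = 2 * s + 1 ∧ j = 2 * t + 1) := by lia
    · obtain ⟨T, hT, h⟩ := exists_posSemidef_quadForm_eq_sq (n := d + 1)
        ((hdeg s t).trans_lt (by lia))
      refine ⟨T, 0, hT, .zero, fun l => ?_⟩
      rw [h, zero_mulVec, dotProduct_zero, mul_zero, add_zero]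
      congr 1
      simp only [eval_mul, eval_pow]
      ring
    · obtain ⟨S, hS, h⟩ := exists_posSemidef_quadForm_eq_sq (n := d)
        ((hdeg s t).trans_lt (by lia))
      refine ⟨0, S, .zero, hS, fun l => ?_⟩
      rw [h, zero_mulVec, dotProduct_zero, zero_add, ← Complex.ofReal_mul]
      congr 1
      simp only [eval_mul, eval_pow, eval_sub, eval_X, eval_C]
      ring
  | zero => exact ⟨0, 0, .zero, .zero, by simp⟩
  | add p q _ _ hp hq =>
    obtain ⟨T, S, hT, hS, h⟩ := hp
    obtain ⟨T', S', hT', hS', h'⟩ := hq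
    refine ⟨T + T', S + S', hT.add hT', hS.add hS', fun l => ?_⟩
    rw [eval_add, Complex.ofReal_add, h, h']
    simp only [add_mulVec, dotProduct_add]
    ring

/-- The polynomial `∑ Aᵢⱼ X^(n-1-i) X^(n-1-j)`. -/
noncomputable def gramPoly {n : ℕ} (A : Matrix (Fin n) (Fin n) ℂ) : ℂ[X] :=
  ∑ i, ∑ j, C (A i j) * X ^ (n - 1 - (i : ℕ) + (n - 1 - (j : ℕ)))

theorem eval_gramPoly {n : ℕ} (A : Matrix (Fin n) (Fin n) ℂ) (l : ℝ) :
    (gramPoly A).eval (l : ℂ) = star (momentVec n l) ⬝ᵥ A *ᵥ momentVec n l := by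
  rw [star_momentVec]
  simp only [gramPoly, momentVec, eval_finsetSum, eval_mul, eval_C, eval_pow, eval_X, dotProduct,
    mulVec, Finset.mul_sum, pow_add]
  exact Finset.sum_congr rfl fun i _ => Finset.sum_congr rfl fun j _ => by ring

theorem natDegree_gramPoly_le {n : ℕ} (A : Matrix (Fin n) (Fin n) ℂ) :
    (gramPoly A).natDegree ≤ 2 * (n - 1) :=
  natDegree_sum_le_of_forall_le _ _ fun _ _ => natDegree_sum_le_of_forall_le _ _ fun _ _ =>
    (natDegree_C_mul_X_pow_le _ _).trans (by lia)

theorem eq_of_eval_ofReal {p q : ℂ[X]} (h : ∀ l : ℝ, p.eval (l : ℂ) = q.eval (l : ℂ)) : p = q :=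
  eq_of_infinite_eval_eq p q <| (Set.infinite_range_of_injective Complex.ofReal_injective).mono <| by
    rintro _ ⟨l, rfl⟩
    exact h l

theorem natDegree_le_of_eval_eq_quadForm {n : ℕ} {A : Matrix (Fin n) (Fin n) ℂ} {q : ℝ[X]}
    (h : ∀ l : ℝ, star (momentVec n l) ⬝ᵥ A *ᵥ momentVec n l = ((q.eval l : ℝ) : ℂ)) :
    q.natDegree ≤ 2 * (n - 1) := by
  have : q.map Complex.ofRealHom = gramPoly A := eq_of_eval_ofReal fun l => by
    rw [eval_gramPoly, h]
    exact eval_map_apply (f := Complex.ofRealHom) l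
  rw [← natDegree_map Complex.ofRealHom, this]
  exact natDegree_gramPoly_le A

theorem exists_pos_sub_mul_pos {a b : ℝ} (hab : a < b) {f g : ℝ → ℝ} (hf : Continuous f)
    (hg : Continuous g) (hpos : ∀ x ∈ Set.Icc a b, 0 < f x) :
    ∃ ε > 0, ∀ x ∈ Set.Icc a b, 0 < f x - ε * g x := by
  obtain ⟨x₀, hx₀, hmin⟩ := isCompact_Icc.exists_isMinOn (Set.nonempty_Icc.2 hab.le)
    hf.continuousOn
  obtain ⟨B, hB⟩ := isCompact_Icc.exists_bound_of_continuousOn (s := Set.Icc a b)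
    hg.continuousOn
  have hδ := hpos x₀ hx₀
  have hB0 : 0 ≤ B := (norm_nonneg _).trans (hB x₀ hx₀)
  refine ⟨f x₀ / (B + 1), by positivity, fun x hx => ?_⟩
  have h₁ : f x₀ ≤ f x := hmin hx
  have h₂ : g x ≤ B := (le_abs_self _).trans (hB x hx)
  have h₃ : f x₀ / (B + 1) * g x < f x₀ := by
    rw [div_mul_eq_mul_div, div_lt_iff₀ (by positivity)]
    nlinarith
  linarith

/-- The polynomial `1 + X² + ⋯ + X^(2(n-1))`. -/
noncomputable def sqGeom (n : ℕ) : ℝ[X] := ∑ i : Fin n, X ^ (2 * (n - 1 - (i : ℕ)))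

theorem natDegree_sqGeom_le (n : ℕ) : (sqGeom n).natDegree ≤ 2 * (n - 1) :=
  natDegree_sum_le_of_forall_le _ _ fun _ _ => (natDegree_X_pow_le _).trans (by lia)

theorem quadForm_one (n : ℕ) (l : ℝ) :
    star (momentVec n l) ⬝ᵥ (1 : Matrix (Fin n) (Fin n) ℂ) *ᵥ momentVec n l =
      (((sqGeom n).eval l : ℝ) : ℂ) := by
  rw [one_mulVec, star_momentVec]
  simp [dotProduct, momentVec, sqGeom, eval_finsetSum, two_mul, pow_add]

theorem exists_posDef_of_pos {a b : ℝ} (hab : a < b) {d : ℕ} (hd : 1 ≤ d) {q : ℝ[X]}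
    (hq : q.natDegree ≤ 2 * d) (hpos : ∀ l ∈ Set.Icc a b, 0 < q.eval l) :
    ∃ (T : Matrix (Fin (d + 1)) (Fin (d + 1)) ℂ) (S : Matrix (Fin d) (Fin d) ℂ),
      T.PosDef ∧ S.PosDef ∧ ∀ l : ℝ, ((q.eval l : ℝ) : ℂ) =
        star (momentVec (d + 1) l) ⬝ᵥ T *ᵥ momentVec (d + 1) l +
        (((l - a) * (b - l) : ℝ) : ℂ) * (star (momentVec d l) ⬝ᵥ S *ᵥ momentVec d l) := by
  set r : ℝ[X] := sqGeom (d + 1) + (X - C a) * (C b - X) * sqGeom d with hr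
  have hrdeg : r.natDegree ≤ 2 * d := by
    refine natDegree_add_le_of_degree_le (natDegree_sqGeom_le _) ?_
    refine (natDegree_mul_le_of_le (natDegree_mul_le_of_le (natDegree_X_sub_C_le a)
      (natDegree_C_sub_X_le b))
      (natDegree_sqGeom_le d)).trans ?_
    simp
    lia
  obtain ⟨ε, hε, h⟩ := exists_pos_sub_mul_pos hab q.continuous r.continuous hpos
  obtain ⟨T, S, hT, hS, hTS⟩ := exists_posSemidef_of_mem_intervalCone
    (mem_intervalCone_of_pos hab (p := q - C ε * r) (n := 2 * d)
      (natDegree_sub_le_of_le hq ((natDegree_C_mul_le _ _).trans hrdeg) |>.trans (by simp))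
      (by simpa using h))
  refine ⟨T + ε • 1, S + ε • 1, .posSemidef_add hT (.smul .one hε),
    .posSemidef_add hS (.smul .one hε), fun l => ?_⟩
  have hl := hTS l
  simp only [eval_sub, eval_mul, eval_C, hr, eval_add, eval_X, Complex.ofReal_sub,
    Complex.ofReal_mul, Complex.ofReal_add] at hl
  simp only [add_mulVec, smul_mulVec, dotProduct_add, dotProduct_smul, quadForm_one,
    Complex.real_smul, Complex.ofReal_sub, Complex.ofReal_mul]
  linear_combination hl

end MomentVec

section LyapAdj

/-- The matrix `(I_d, 0)`. -/
abbrev initMatrix (d : ℕ) : Matrix (Fin d) (Fin (d + 1)) ℂ :=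
  Matrix.of fun i j => if (j : ℕ) = (i : ℕ) then (1 : ℂ) else 0

/-- The matrix `(0, I_d)`. -/
abbrev tailMatrix (d : ℕ) : Matrix (Fin d) (Fin (d + 1)) ℂ :=
  Matrix.of fun i j => if (j : ℕ) = (i : ℕ) + 1 then (1 : ℂ) else 0

theorem initMatrix_mulVec {d : ℕ} (v : Fin (d + 1) → ℂ) (i : Fin d) :
    (initMatrix d *ᵥ v) i = v i.castSucc := by
  have : ∀ j : Fin (d + 1), (j : ℕ) = i ↔ j = i.castSucc := fun j => by simp [Fin.ext_iff]
  simp [mulVec, dotProduct, this]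

theorem tailMatrix_mulVec {d : ℕ} (v : Fin (d + 1) → ℂ) (i : Fin d) :
    (tailMatrix d *ᵥ v) i = v i.succ := by
  have : ∀ j : Fin (d + 1), (j : ℕ) = i + 1 ↔ j = i.succ := fun j => by simp [Fin.ext_iff]
  simp [mulVec, dotProduct, this]

theorem tailMatrix_mulVec_momentVec (d : ℕ) (l : ℝ) :
    tailMatrix d *ᵥ momentVec (d + 1) l = momentVec d l := by
  ext i
  rw [tailMatrix_mulVec]
  simp only [momentVec, Fin.val_succ]
  congr 1
  lia

theorem initMatrix_mulVec_momentVec (d : ℕ) (l : ℝ) :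
    initMatrix d *ᵥ momentVec (d + 1) l = (l : ℂ) • momentVec d l := by
  ext i
  rw [initMatrix_mulVec]
  simp only [momentVec, Fin.val_castSucc, Pi.smul_apply, smul_eq_mul, ← pow_succ']
  congr 1
  lia

theorem quadForm_lyapAdj {k z : Type*} [Fintype k] [Fintype z] (M N : Matrix k z ℂ)
    (Θ : Matrix (Fin 2) (Fin 2) ℂ) (H : Matrix k k ℂ) (v : z → ℂ) (l : ℝ)
    (h : M *ᵥ v = (l : ℂ) • (N *ᵥ v)) :
    star v ⬝ᵥ lyapAdj M N Θ H *ᵥ v =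
      (Θ 0 0 * l ^ 2 + (Θ 1 0 + Θ 0 1) * l + Θ 1 1) * (star (N *ᵥ v) ⬝ᵥ H *ᵥ (N *ᵥ v)) := by
  have key : ∀ A B : Matrix k z ℂ,
      star v ⬝ᵥ (Aᴴ * H * B) *ᵥ v = star (A *ᵥ v) ⬝ᵥ H *ᵥ (B *ᵥ v) := by
    intro A B
    rw [star_mulVec, ← dotProduct_mulVec, mulVec_mulVec, mulVec_mulVec, Matrix.mul_assoc]
  simp only [lyapAdj, add_mulVec, smul_mulVec, dotProduct_add, dotProduct_smul, key, h, star_smul,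
    smul_dotProduct, mulVec_smul, smul_eq_mul, RCLike.star_def, Complex.conj_ofReal]
  ring

theorem quadForm_lyapAdj_momentVec {d : ℕ} (Θ : Matrix (Fin 2) (Fin 2) ℂ)
    (H : Matrix (Fin d) (Fin d) ℂ) (l : ℝ) :
    star (momentVec (d + 1) l) ⬝ᵥ lyapAdj (initMatrix d) (tailMatrix d) Θ H *ᵥ
        momentVec (d + 1) l =
      (Θ 0 0 * l ^ 2 + (Θ 1 0 + Θ 0 1) * l + Θ 1 1) *
        (star (momentVec d l) ⬝ᵥ H *ᵥ momentVec d l) := by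
  rw [quadForm_lyapAdj _ _ _ _ _ l (by
    rw [initMatrix_mulVec_momentVec, tailMatrix_mulVec_momentVec]), tailMatrix_mulVec_momentVec]

theorem conjTranspose_lyapAdj {k z : Type*} [Fintype k] (M N : Matrix k z ℂ)
    {Θ : Matrix (Fin 2) (Fin 2) ℂ} (hΘ : Θ.IsHermitian) (H : Matrix k k ℂ) :
    (lyapAdj M N Θ H)ᴴ = lyapAdj M N Θ Hᴴ := by
  simp only [lyapAdj, conjTranspose_add, conjTranspose_smul, conjTranspose_mul,
    conjTranspose_conjTranspose, hΘ.apply, Matrix.mul_assoc]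
  abel

theorem lyapAdj_add {k z : Type*} [Fintype k] (M N : Matrix k z ℂ)
    (Θ : Matrix (Fin 2) (Fin 2) ℂ) (H K : Matrix k k ℂ) :
    lyapAdj M N Θ (H + K) = lyapAdj M N Θ H + lyapAdj M N Θ K := by
  simp only [lyapAdj, Matrix.mul_add, Matrix.add_mul, smul_add]
  abel

theorem lyapAdj_smul {k z : Type*} [Fintype k] (M N : Matrix k z ℂ)
    (Θ : Matrix (Fin 2) (Fin 2) ℂ) (c : ℂ) (H : Matrix k k ℂ) :
    lyapAdj M N Θ (c • H) = c • lyapAdj M N Θ H := by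
  simp only [lyapAdj, Matrix.mul_smul, Matrix.smul_mul, smul_add, smul_comm c]

/-- Entries of `M* H N` in terms of a zero-extension of `H` to `ℕ × ℕ`. -/
theorem conjTranspose_initMatrix_mul_mul_tailMatrix_apply {d : ℕ} (h : ℕ → ℕ → ℂ)
    (hd : ∀ k, h d k = 0) (i j : Fin (d + 1)) :
    ((initMatrix d)ᴴ * Matrix.of (fun s t : Fin d => h s t) * tailMatrix d) i j =
      if (j : ℕ) = 0 then 0 else h i (j - 1) := by
  have hj : ∀ t : Fin d, (j : ℕ) = t + 1 ↔ j = t.succ := fun j => by simp [Fin.ext_iff]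
  have hi : ∀ t : Fin d, (i : ℕ) = t ↔ i = t.castSucc := fun j => by simp [Fin.ext_iff]
  simp only [Matrix.mul_apply, conjTranspose_apply, of_apply, hj, hi]
  cases j using Fin.cases with
  | zero => simp [Fin.succ_ne_zero, eq_comm (a := (0 : Fin (d + 1)))]
  | succ j =>
    cases i using Fin.lastCases with
    | last => simp [hd, (Fin.castSucc_ne_last _).symm]
    | cast i => simp

theorem conjTranspose_tailMatrix_mul_mul_initMatrix_apply {d : ℕ} (h : ℕ → ℕ → ℂ)
    (hd : ∀ k, h k d = 0) (i j : Fin (d + 1)) :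
    ((tailMatrix d)ᴴ * Matrix.of (fun s t : Fin d => h s t) * initMatrix d) i j =
      if (i : ℕ) = 0 then 0 else h (i - 1) j := by
  have hj : ∀ t : Fin d, (j : ℕ) = t ↔ j = t.castSucc := fun j => by simp [Fin.ext_iff]
  have hi : ∀ t : Fin d, (i : ℕ) = t + 1 ↔ i = t.succ := fun j => by simp [Fin.ext_iff]
  simp only [Matrix.mul_apply, conjTranspose_apply, of_apply, hj, hi]
  cases i using Fin.cases with
  | zero => simp [Fin.succ_ne_zero, eq_comm (a := (0 : Fin (d + 1)))]
  | succ i =>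
    cases j using Fin.lastCases with
    | last => simp [hd, (Fin.castSucc_ne_last _).symm]
    | cast j => simp

/-- Extension of a square matrix by zero to `ℕ × ℕ`. -/
def zeroExtend {n : ℕ} (A : Matrix (Fin n) (Fin n) ℂ) (i j : ℕ) : ℂ :=
  if h : i < n ∧ j < n then A ⟨i, h.1⟩ ⟨j, h.2⟩ else 0

theorem zeroExtend_val {n : ℕ} (A : Matrix (Fin n) (Fin n) ℂ) (i j : Fin n) :
    zeroExtend A i j = A i j := by
  simp [zeroExtend]

theorem sum_antidiagonal_zeroExtend {n : ℕ} {A : Matrix (Fin n) (Fin n) ℂ}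
    (hA : ∀ l : ℝ, star (momentVec n l) ⬝ᵥ A *ᵥ momentVec n l = 0) (s : ℕ) :
    ∑ t ∈ Finset.range (s + 1), zeroExtend A t (s - t) = 0 := by
  have hP : gramPoly A = 0 := eq_of_eval_ofReal fun l => by
    rw [eval_gramPoly, hA, Polynomial.eval_zero]
  have hc := congrArg (Polynomial.coeff · (2 * (n - 1) - s)) hP
  by_cases hs : 2 * (n - 1) < s
  · refine Finset.sum_eq_zero fun t ht => dif_neg ?_
    rw [Finset.mem_range] at ht
    lia
  simp only [gramPoly, Polynomial.finsetSum_coeff, Polynomial.coeff_C_mul_X_pow,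
    Polynomial.coeff_zero] at hc
  rw [← hc, ← Finset.sum_product', Finset.univ_product_univ]
  simp only [← Finset.sum_filter]
  symm
  refine Finset.sum_of_injOn (fun x => (x.1 : ℕ)) ?_ ?_ ?_ ?_
  · rintro ⟨i, j⟩ hx ⟨i', j'⟩ hy hxy
    simp only [Finset.coe_filter, Finset.mem_univ, true_and, Set.mem_ofPred_eq] at hx hy hxy
    ext <;> simp only <;> lia
  · rintro ⟨i, j⟩ hx
    simp only [Finset.coe_filter, Finset.mem_univ, true_and, Set.mem_ofPred_eq,
      Finset.coe_range, Set.mem_Iio] at hx ⊢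
    lia
  · intro t ht hx
    refine dif_neg fun h => hx ?_
    rw [Finset.mem_range] at ht
    refine ⟨(⟨t, h.1⟩, ⟨s - t, h.2⟩), ?_, rfl⟩
    simp only [Finset.coe_filter, Finset.mem_univ, true_and, Set.mem_ofPred_eq]
    lia
  · rintro ⟨i, j⟩ hx
    simp only [Finset.mem_filter, Finset.mem_univ, true_and] at hx
    rw [show s - (i : ℕ) = j by lia, zeroExtend_val]

theorem exists_lyapAdj_eq {d : ℕ} {A : Matrix (Fin (d + 1)) (Fin (d + 1)) ℂ}
    (hA : ∀ l : ℝ, star (momentVec (d + 1) l) ⬝ᵥ A *ᵥ momentVec (d + 1) l = 0) :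
    ∃ H : Matrix (Fin d) (Fin d) ℂ,
      lyapAdj (initMatrix d) (tailMatrix d) !![0, -Complex.I; Complex.I, 0] H = A := by
  have hanti := sum_antidiagonal_zeroExtend hA
  set F := zeroExtend A with hF
  set h : ℕ → ℕ → ℂ := fun i j => ∑ t ∈ Finset.range (i + 1), F t (i + j + 1 - t) with hh
  have hl : ∀ k, h d k = 0 := by
    intro k
    rw [← hanti (d + k + 1)]
    refine Finset.sum_subset (by simp; lia) fun t _ ht => dif_neg ?_
    rw [Finset.mem_range] at ht
    lia
  have hr : ∀ k, h k d = 0 := by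
    intro k
    refine Finset.sum_eq_zero fun t ht => dif_neg ?_
    rw [Finset.mem_range] at ht
    lia
  have hrec : ∀ i j : ℕ,
      ((if j = 0 then 0 else h i (j - 1)) - if i = 0 then 0 else h (i - 1) j) = F i j := by
    intro i j
    have h₁ : (if j = 0 then 0 else h i (j - 1)) = ∑ t ∈ Finset.range (i + 1), F t (i + j - t) := by
      split_ifs with hj
      · rw [hj, ← hanti i, add_zero]
      · rw [hh]
        simp only [show i + (j - 1) + 1 = i + j by lia]
    have h₂ : (if i = 0 then 0 else h (i - 1) j) = ∑ t ∈ Finset.range i, F t (i + j - t) := by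
      split_ifs with hi
      · simp [hi]
      · simp only [hh, show i - 1 + j + 1 = i + j by lia, show i - 1 + 1 = i by lia]
    rw [h₁, h₂, Finset.sum_range_succ]
    simp
  refine ⟨-Complex.I • Matrix.of fun s t : Fin d => h s t, ?_⟩
  rw [lyapAdj_smul]
  ext i j
  have := hrec i j
  rw [hF, zeroExtend_val, ← conjTranspose_initMatrix_mul_mul_tailMatrix_apply h hl,
    ← conjTranspose_tailMatrix_mul_mul_initMatrix_apply h hr] at this
  simp only [lyapAdj, Matrix.smul_apply, Matrix.add_apply, smul_eq_mul, of_apply, cons_val',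
    cons_val_zero, cons_val_one, cons_val_fin_one, zero_mul, zero_add, add_zero]
  rw [← this]
  linear_combination (-(((initMatrix d)ᴴ * Matrix.of (fun s t : Fin d => h s t) * tailMatrix d) i j
    - ((tailMatrix d)ᴴ * Matrix.of (fun s t : Fin d => h s t) * initMatrix d) i j)) * Complex.I_mul_I

theorem exists_isHermitian_lyapAdj_eq {d : ℕ} {A : Matrix (Fin (d + 1)) (Fin (d + 1)) ℂ}
    (hAh : A.IsHermitian)
    (hA : ∀ l : ℝ, star (momentVec (d + 1) l) ⬝ᵥ A *ᵥ momentVec (d + 1) l = 0) :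
    ∃ H : Matrix (Fin d) (Fin d) ℂ, H.IsHermitian ∧
      lyapAdj (initMatrix d) (tailMatrix d) !![0, -Complex.I; Complex.I, 0] H = A := by
  obtain ⟨H, hH⟩ := exists_lyapAdj_eq hA
  have hΘ : (!![0, -Complex.I; Complex.I, 0] : Matrix (Fin 2) (Fin 2) ℂ).IsHermitian := by
    ext i j
    fin_cases i <;> fin_cases j <;> simp
  refine ⟨(1 / 2 : ℂ) • (H + Hᴴ), ?_, ?_⟩
  · rw [IsHermitian, conjTranspose_smul, conjTranspose_add, conjTranspose_conjTranspose, add_comm]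
    simp
  · rw [lyapAdj_smul, lyapAdj_add, ← conjTranspose_lyapAdj _ _ hΘ, hH, hAh.eq, ← two_smul ℂ A,
      smul_smul]
    norm_num

end LyapAdj

/-- **Positivity of a one-variable polynomial on an interval as an LMI.**
Let `q` be a real polynomial, `d ≥ 1`, and `G` a Hermitian `(d+1) × (d+1)` matrix with
`ζ(λ) G ζ(λ)* = q(λ)` for all real `λ`, where `ζ(λ) = (λ^d, …, λ, 1)`.  With
`M = (I_d, 0)`, `N = (0, I_d)`, `Θ₁ = [[0, −i], [i, 0]]` and
`Θ₂ = [[−1, (a+b)/2], [(a+b)/2, −ab]]` (`a < b`), `q` is positive on `[a, b]` iff there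
are Hermitian `H₁, H₂` with `H₂ ≻ 0` and `G ≻ Λ'_{M,N,Θ₁}(H₁) + Λ'_{M,N,Θ₂}(H₂)`. -/
theorem polynomial_pos_on_Icc_iff_LMI
    (d : ℕ) (hd : 1 ≤ d) (q : Polynomial ℝ)
    (G : Matrix (Fin (d + 1)) (Fin (d + 1)) ℂ) (hG : G.IsHermitian)
    (hGq : ∀ l : ℝ,
      ((fun i : Fin (d + 1) => ((l : ℂ)) ^ (d - (i : ℕ))) ⬝ᵥ
          G *ᵥ star fun i : Fin (d + 1) => ((l : ℂ)) ^ (d - (i : ℕ)))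
        = ((q.eval l : ℝ) : ℂ))
    (a b : ℝ) (hab : a < b) :
    (∀ l ∈ Set.Icc a b, 0 < q.eval l)
      ↔
    (∃ H₁ H₂ : Matrix (Fin d) (Fin d) ℂ, H₁.IsHermitian ∧ H₂.IsHermitian ∧ H₂.PosDef ∧
        (G - (lyapAdj (Matrix.of fun (i : Fin d) (j : Fin (d + 1)) =>
                if (j : ℕ) = (i : ℕ) then (1 : ℂ) else 0)
              (Matrix.of fun (i : Fin d) (j : Fin (d + 1)) =>
                if (j : ℕ) = (i : ℕ) + 1 then (1 : ℂ) else 0)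
              !![0, -Complex.I; Complex.I, 0] H₁ +
            lyapAdj (Matrix.of fun (i : Fin d) (j : Fin (d + 1)) =>
                if (j : ℕ) = (i : ℕ) then (1 : ℂ) else 0)
              (Matrix.of fun (i : Fin d) (j : Fin (d + 1)) =>
                if (j : ℕ) = (i : ℕ) + 1 then (1 : ℂ) else 0)
              !![(-1 : ℂ), (((a + b) / 2 : ℝ) : ℂ);
                 (((a + b) / 2 : ℝ) : ℂ), ((-(a * b) : ℝ) : ℂ)] H₂)).PosDef) := by
  have hζ : ∀ l : ℝ, star (momentVec (d + 1) l) ⬝ᵥ G *ᵥ momentVec (d + 1) l =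
      ((q.eval l : ℝ) : ℂ) := by
    intro l
    have h : _ ⬝ᵥ G *ᵥ star (momentVec (d + 1) l) = _ := hGq l
    rw [star_momentVec] at h ⊢
    exact h
  set Θ₁ : Matrix (Fin 2) (Fin 2) ℂ := !![0, -Complex.I; Complex.I, 0] with hΘ₁
  set Θ₂ : Matrix (Fin 2) (Fin 2) ℂ := !![(-1 : ℂ), (((a + b) / 2 : ℝ) : ℂ);
    (((a + b) / 2 : ℝ) : ℂ), ((-(a * b) : ℝ) : ℂ)] with hΘ₂
  have hquad₁ : ∀ (H : Matrix (Fin d) (Fin d) ℂ) (l : ℝ),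
      star (momentVec (d + 1) l) ⬝ᵥ lyapAdj (initMatrix d) (tailMatrix d) Θ₁ H *ᵥ
        momentVec (d + 1) l = 0 := by
    intro H l
    rw [quadForm_lyapAdj_momentVec]
    simp [hΘ₁]
  have hquad₂ : ∀ (H : Matrix (Fin d) (Fin d) ℂ) (l : ℝ),
      star (momentVec (d + 1) l) ⬝ᵥ lyapAdj (initMatrix d) (tailMatrix d) Θ₂ H *ᵥ
        momentVec (d + 1) l =
      (((l - a) * (b - l) : ℝ) : ℂ) * (star (momentVec d l) ⬝ᵥ H *ᵥ momentVec d l) := by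
    intro H l
    rw [quadForm_lyapAdj_momentVec]
    congr 1
    simp [hΘ₂]
    ring
  have hherm₂ : Θ₂.IsHermitian := by
    ext i j
    fin_cases i <;> fin_cases j <;> simp [hΘ₂]
  constructor
  · intro hpos
    obtain ⟨T, S, hT, hS, hTS⟩ :=
      exists_posDef_of_pos hab hd (natDegree_le_of_eval_eq_quadForm hζ) hpos
    obtain ⟨H, hH, hHA⟩ := exists_isHermitian_lyapAdj_eq
      (A := G - lyapAdj (initMatrix d) (tailMatrix d) Θ₂ S - T)
      ((hG.sub (by rw [IsHermitian, conjTranspose_lyapAdj _ _ hherm₂, hS.1.eq])).sub hT.1)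
      fun l => by
        rw [sub_mulVec, sub_mulVec, dotProduct_sub, dotProduct_sub, hζ, hquad₂, hTS]
        ring
    refine ⟨H, S, hH, hS.1, hS, ?_⟩
    convert hT using 1
    rw [hHA]
    abel
  · rintro ⟨H₁, H₂, -, -, hH₂, hpd⟩ l hl
    have hne : momentVec (d + 1) l ≠ 0 := fun h => by
      simpa [momentVec] using congrFun h (Fin.last d)
    have h₁ := hpd.dotProduct_mulVec_pos hne
    have h₂ := hH₂.posSemidef.dotProduct_mulVec_nonneg (momentVec d l)
    have h₃ : (0 : ℂ) ≤ (((l - a) * (b - l) : ℝ) : ℂ) :=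
      Complex.zero_le_real.2 (mul_nonneg (sub_nonneg.2 hl.1) (sub_nonneg.2 hl.2))
    rw [sub_mulVec, add_mulVec, dotProduct_sub, dotProduct_add, hζ, hquad₁, hquad₂, zero_add,
      sub_pos] at h₁
    exact Complex.zero_lt_real.1 ((mul_nonneg h₃ h₂).trans_lt h₁)
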